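/- arXiv:1803.03116 — 3 statements merged into one kernel-verified Lean document; each statement's English description precedes it below -/
import Mathlib

section
/- Let a, b, c, d, e, f, g ∈ ℂ with e, f, g not equal to a nonpositive integer. Then the function u(x,y) = F1(a,b,c,d;e,f;g;x,y) satisfies, at every point of D = {(x,y) ∈ ℝ² : 0 < x < 1, 0 < y}, the fourth-order partial differential equation y³·u_yyyy + x²y·u_xxyy + 2xy²·u_xyyy + (e+f+g+3)y²·u_yyy + (e+f+2g+3)xy·u_xyy + g x²·u_xxy + ([(e+1)(f+1)+(e+f+1)g] − y)·y·u_yy + [(e+f+1)g − y]·x·u_xy − dx·u_x + [efg − (a+d+1)y]·u_y − ad·u = 0. -/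
noncomputable def poch (a : ℂ) (n : ℕ) : ℂ := ∏ i ∈ Finset.range n, (a + i)

noncomputable def pdx (u : ℝ → ℝ → ℂ) : ℝ → ℝ → ℂ := fun x y => deriv (fun t => u t y) x
noncomputable def pdy (u : ℝ → ℝ → ℂ) : ℝ → ℝ → ℂ := fun x y => deriv (fun t => u x t) y

/-- Kampé de Fériet function of the fourth order. -/
noncomputable def F1 (a b c d e f g x y : ℂ) : ℂ :=
  ∑' p : ℕ × ℕ,
    poch a (p.1 + p.2) * poch b p.1 * poch c p.1 * poch d p.2 /
      (poch e (p.1 + p.2) * poch f (p.1 + p.2) * poch g p.2 *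
        (Nat.factorial p.1 : ℂ) * (Nat.factorial p.2 : ℂ)) * x ^ p.1 * y ^ p.2

open Filter Topology

/-- Coefficients of double power series converging absolutely on `|x| < 1`, `y` arbitrary. -/
def StripSummable (A : ℕ × ℕ → ℂ) : Prop :=
  ∀ r R : ℝ, 0 < r → r < 1 → 0 < R → Summable fun p : ℕ × ℕ => ‖A p‖ * r ^ p.1 * R ^ p.2

/-- The sum of the double power series with coefficients `A`. -/
noncomputable def doubleSeries (A : ℕ × ℕ → ℂ) (x y : ℝ) : ℂ :=
  ∑' p : ℕ × ℕ, A p * (x : ℂ) ^ p.1 * (y : ℂ) ^ p.2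

/-- Coefficients of the mixed partial derivative of order `(i, j)` of a double power series. -/
def derivCoeff (i j : ℕ) (A : ℕ × ℕ → ℂ) : ℕ × ℕ → ℂ := fun p =>
  ((p.1 + i).descFactorial i : ℂ) * ((p.2 + j).descFactorial j : ℂ) * A (p.1 + i, p.2 + j)

theorem add_succ_descFactorial_succ (m i : ℕ) :
    (m + (i + 1)).descFactorial (i + 1) = (m + 1) * (m + 1 + i).descFactorial i := by
  rw [Nat.descFactorial_succ, show m + (i + 1) - i = m + 1 by omega,
    show m + (i + 1) = m + 1 + i by omega]

theorem derivCoeff_succ_left (i j : ℕ) (A : ℕ × ℕ → ℂ) (p : ℕ × ℕ) :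
    derivCoeff (i + 1) j A p = (p.1 + 1) * derivCoeff i j A (p.1 + 1, p.2) := by
  simp only [derivCoeff, add_succ_descFactorial_succ]
  rw [show p.1 + (i + 1) = p.1 + 1 + i by omega]
  push_cast
  ring

theorem derivCoeff_succ_right (i j : ℕ) (A : ℕ × ℕ → ℂ) (p : ℕ × ℕ) :
    derivCoeff i (j + 1) A p = (p.2 + 1) * derivCoeff i j A (p.1, p.2 + 1) := by
  simp only [derivCoeff, add_succ_descFactorial_succ]
  rw [show p.2 + (j + 1) = p.2 + 1 + j by omega]
  push_cast
  ring

theorem derivCoeff_zero_zero (A : ℕ × ℕ → ℂ) : derivCoeff 0 0 A = A := by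
  ext p
  simp [derivCoeff]

theorem exists_natCast_mul_pow_pred_le {s t : ℝ} (hs : 0 < s) (hst : s < t) :
    ∃ C : ℝ, 0 ≤ C ∧ ∀ k : ℕ, (k : ℝ) * s ^ (k - 1) ≤ C * t ^ k := by
  have ht : 0 < t := hs.trans hst
  have hq : ‖s / t‖ < 1 := by
    rw [Real.norm_of_nonneg (by positivity)]
    exact (div_lt_one ht).2 hst
  have hsum : Summable fun k : ℕ => (k : ℝ) * (s / t) ^ k := by
    simpa using summable_pow_mul_geometric_of_norm_lt_one 1 hq
  have hC : 0 ≤ (∑' k : ℕ, (k : ℝ) * (s / t) ^ k) / s :=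
    div_nonneg (tsum_nonneg fun k => by positivity) hs.le
  refine ⟨_, hC, fun k => ?_⟩
  rcases k with _ | k
  · simpa using hC
  · have h := hsum.le_tsum (k + 1) (fun j _ => by positivity)
    rw [div_mul_eq_mul_div, le_div_iff₀ hs]
    rw [div_pow, mul_div_assoc', div_le_iff₀ (by positivity)] at h
    calc _ = ((k + 1 : ℕ) : ℝ) * s ^ (k + 1) := by rw [Nat.add_sub_cancel, mul_assoc, ← pow_succ]
      _ ≤ _ := h

theorem StripSummable.derivCoeff_succ_left {i j : ℕ} {A : ℕ × ℕ → ℂ}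
    (hA : StripSummable (derivCoeff i j A)) : StripSummable (derivCoeff (i + 1) j A) := by
  intro r R hr hr1 hR
  obtain ⟨t, hrt, ht1⟩ := exists_between hr1
  have ht : 0 < t := hr.trans hrt
  obtain ⟨C, -, hC⟩ := exists_natCast_mul_pow_pred_le hr hrt
  have hinj : Function.Injective fun p : ℕ × ℕ => (p.1 + 1, p.2) := by
    rintro ⟨m, n⟩ ⟨m', n'⟩ h
    simpa using h
  refine (((hA t R ht ht1 hR).comp_injective hinj).mul_left C).of_nonneg_of_le
    (fun p => by positivity) fun p => ?_
  rw [_root_.derivCoeff_succ_left, norm_mul]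
  have h := hC (p.1 + 1)
  rw [Nat.add_sub_cancel] at h
  have h1 : ‖(p.1 + 1 : ℂ)‖ = ((p.1 + 1 : ℕ) : ℝ) := by
    rw [← Nat.cast_add_one, Complex.norm_natCast]
  rw [h1]
  have := mul_le_mul_of_nonneg_left h
    (show 0 ≤ ‖derivCoeff i j A (p.1 + 1, p.2)‖ * R ^ p.2 by positivity)
  simp only [Function.comp_apply]
  linarith

theorem StripSummable.derivCoeff_succ_right {i j : ℕ} {A : ℕ × ℕ → ℂ}
    (hA : StripSummable (derivCoeff i j A)) : StripSummable (derivCoeff i (j + 1) A) := by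
  intro r R hr hr1 hR
  have hRt : R < R + 1 := by linarith
  have ht : 0 < R + 1 := hR.trans hRt
  obtain ⟨C, -, hC⟩ := exists_natCast_mul_pow_pred_le hR hRt
  have hinj : Function.Injective fun p : ℕ × ℕ => (p.1, p.2 + 1) := by
    rintro ⟨m, n⟩ ⟨m', n'⟩ h
    simpa using h
  refine (((hA r (R + 1) hr hr1 ht).comp_injective hinj).mul_left C).of_nonneg_of_le
    (fun p => by positivity) fun p => ?_
  rw [_root_.derivCoeff_succ_right, norm_mul]
  have h := hC (p.2 + 1)
  rw [Nat.add_sub_cancel] at h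
  have h1 : ‖(p.2 + 1 : ℂ)‖ = ((p.2 + 1 : ℕ) : ℝ) := by
    rw [← Nat.cast_add_one, Complex.norm_natCast]
  rw [h1]
  have := mul_le_mul_of_nonneg_left h
    (show 0 ≤ ‖derivCoeff i j A (p.1, p.2 + 1)‖ * r ^ p.1 by positivity)
  simp only [Function.comp_apply]
  linarith

theorem StripSummable.derivCoeff {A : ℕ × ℕ → ℂ} (hA : StripSummable A) (i j : ℕ) :
    StripSummable (derivCoeff i j A) := by
  induction i with
  | zero =>
    induction j with
    | zero => rwa [derivCoeff_zero_zero]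
    | succ j ih => exact ih.derivCoeff_succ_right
  | succ i ih => exact ih.derivCoeff_succ_left

theorem StripSummable.summable {A : ℕ × ℕ → ℂ} (hA : StripSummable A) {x y : ℝ}
    (hx : |x| < 1) : Summable fun p : ℕ × ℕ => A p * (x : ℂ) ^ p.1 * (y : ℂ) ^ p.2 := by
  obtain ⟨r, hr, hr1⟩ := exists_between hx
  have hr0 : 0 < r := (abs_nonneg x).trans_lt hr
  refine Summable.of_norm_bounded (hA r (|y| + 1) hr0 hr1 (by positivity)) fun p => ?_
  rw [norm_mul, norm_mul, norm_pow, norm_pow, Complex.norm_real, Complex.norm_real,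
    Real.norm_eq_abs, Real.norm_eq_abs]
  have : |y| ≤ |y| + 1 := by linarith
  gcongr

theorem hasDerivAt_tsum_mul_pow {ι : Type*} (c : ι → ℂ) (k : ι → ℕ) {ρ x : ℝ} (hx : |x| < ρ)
    (hc : Summable fun i => ‖c i‖ * ρ ^ k i) :
    HasDerivAt (fun t : ℝ => ∑' i, c i * (t : ℂ) ^ k i)
      (∑' i, c i * ((k i : ℂ) * (x : ℂ) ^ (k i - 1))) x := by
  obtain ⟨s, hxs, hsρ⟩ := exists_between hx
  have hs : 0 < s := (abs_nonneg x).trans_lt hxs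
  obtain ⟨C, hC0, hC⟩ := exists_natCast_mul_pow_pred_le hs hsρ
  have hxm : x ∈ Set.Ioo (-s) s := abs_lt.1 hxs
  refine hasDerivAt_tsum_of_isPreconnected (hc.mul_left C) isOpen_Ioo isPreconnected_Ioo
    (g := fun i (t : ℝ) => c i * (t : ℂ) ^ k i)
    (g' := fun i (t : ℝ) => c i * ((k i : ℂ) * (t : ℂ) ^ (k i - 1)))
    (fun i t _ => ?_) (fun i t ht => ?_) hxm ?_ hxm
  · have h := ((hasDerivAt_pow (k i) (t : ℂ)).comp_ofReal).const_mul (c i)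
    simpa using h
  · rw [norm_mul, norm_mul, norm_pow, Complex.norm_real, Complex.norm_natCast, Real.norm_eq_abs]
    have ht' : |t| ≤ s := (abs_lt.2 ht).le
    calc ‖c i‖ * ((k i : ℝ) * |t| ^ (k i - 1)) ≤ ‖c i‖ * ((k i : ℝ) * s ^ (k i - 1)) := by gcongr
      _ ≤ ‖c i‖ * (C * ρ ^ k i) := mul_le_mul_of_nonneg_left (hC _) (norm_nonneg _)
      _ = _ := by ring
  · refine Summable.of_norm_bounded hc fun i => ?_
    rw [norm_mul, norm_pow, Complex.norm_real, Real.norm_eq_abs]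
    gcongr

theorem pdx_eq_of_eq_doubleSeries {A : ℕ × ℕ → ℂ} (hA : StripSummable A) {i j : ℕ}
    {v : ℝ → ℝ → ℂ} (hv : ∀ x y, |x| < 1 → v x y = doubleSeries (derivCoeff i j A) x y) :
    ∀ x y, |x| < 1 → pdx v x y = doubleSeries (derivCoeff (i + 1) j A) x y := by
  intro x y hx
  obtain ⟨r, hr, hr1⟩ := exists_between hx
  have hr0 : 0 < r := (abs_nonneg x).trans_lt hr
  set B := derivCoeff i j A
  have hsum : Summable fun p : ℕ × ℕ => ‖B p * (y : ℂ) ^ p.2‖ * r ^ p.1 := by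
    refine ((hA.derivCoeff i j) r (|y| + 1) hr0 hr1 (by positivity)).of_nonneg_of_le
      (fun p => by positivity) fun p => ?_
    rw [norm_mul, norm_pow, Complex.norm_real, Real.norm_eq_abs, mul_right_comm]
    have : |y| ≤ |y| + 1 := by linarith
    gcongr
  have hd := hasDerivAt_tsum_mul_pow (fun p : ℕ × ℕ => B p * (y : ℂ) ^ p.2) Prod.fst hr hsum
  have hev : (fun t => v t y) =ᶠ[𝓝 x]
      fun t : ℝ => ∑' p : ℕ × ℕ, B p * (y : ℂ) ^ p.2 * (t : ℂ) ^ p.1 := by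
    filter_upwards [(continuous_abs.tendsto x).eventually (gt_mem_nhds hx)] with t ht
    rw [hv t y ht]
    exact tsum_congr fun p => by ring
  have hinj : Function.Injective fun p : ℕ × ℕ => (p.1 + 1, p.2) := by
    rintro ⟨m, n⟩ ⟨m', n'⟩ h
    simpa using h
  rw [pdx, hev.deriv_eq, hd.deriv, ← hinj.tsum_eq, doubleSeries]
  · refine tsum_congr fun p => ?_
    rw [derivCoeff_succ_left]
    simp only [Nat.add_sub_cancel]
    push_cast
    ring
  · rintro ⟨m, n⟩ h
    rcases m with _ | m
    · simp at h
    · exact ⟨(m, n), rfl⟩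

theorem pdy_eq_of_eq_doubleSeries {A : ℕ × ℕ → ℂ} (hA : StripSummable A) {i j : ℕ}
    {v : ℝ → ℝ → ℂ} (hv : ∀ x y, |x| < 1 → v x y = doubleSeries (derivCoeff i j A) x y) :
    ∀ x y, |x| < 1 → pdy v x y = doubleSeries (derivCoeff i (j + 1) A) x y := by
  intro x y hx
  obtain ⟨r, hr, hr1⟩ := exists_between hx
  have hr0 : 0 < r := (abs_nonneg x).trans_lt hr
  set B := derivCoeff i j A
  have hsum : Summable fun p : ℕ × ℕ => ‖B p * (x : ℂ) ^ p.1‖ * (|y| + 1) ^ p.2 := by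
    refine ((hA.derivCoeff i j) r (|y| + 1) hr0 hr1 (by positivity)).of_nonneg_of_le
      (fun p => by positivity) fun p => ?_
    rw [norm_mul, norm_pow, Complex.norm_real, Real.norm_eq_abs]
    gcongr
  have hd := hasDerivAt_tsum_mul_pow (fun p : ℕ × ℕ => B p * (x : ℂ) ^ p.1) Prod.snd
    (lt_add_one |y|) hsum
  have hev : (fun t => v x t) =
      fun t : ℝ => ∑' p : ℕ × ℕ, B p * (x : ℂ) ^ p.1 * (t : ℂ) ^ p.2 :=
    funext fun t => hv x t hx
  have hinj : Function.Injective fun p : ℕ × ℕ => (p.1, p.2 + 1) := by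
    rintro ⟨m, n⟩ ⟨m', n'⟩ h
    simpa using h
  rw [pdy, hev, hd.deriv, ← hinj.tsum_eq, doubleSeries]
  · refine tsum_congr fun p => ?_
    rw [derivCoeff_succ_right]
    simp only [Nat.add_sub_cancel]
    push_cast
    ring
  · rintro ⟨m, n⟩ h
    rcases n with _ | n
    · simp at h
    · exact ⟨(m, n), rfl⟩

/-- Multiplying the derivative of order `(i, j)` by `x ^ i * y ^ j` multiplies the coefficients
by falling factorials. -/
theorem StripSummable.hasSum_descFactorial {A : ℕ × ℕ → ℂ} (hA : StripSummable A) (i j : ℕ)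
    {x y : ℝ} (hx : |x| < 1) :
    HasSum (fun p : ℕ × ℕ => (p.1.descFactorial i : ℂ) * (p.2.descFactorial j : ℂ) *
        (A p * (x : ℂ) ^ p.1 * (y : ℂ) ^ p.2))
      ((x : ℂ) ^ i * (y : ℂ) ^ j * doubleSeries (_root_.derivCoeff i j A) x y) := by
  have hinj : Function.Injective fun p : ℕ × ℕ => (p.1 + i, p.2 + j) := by
    rintro ⟨m, n⟩ ⟨m', n'⟩ h
    simpa using h
  rw [← hinj.hasSum_iff]
  · refine (((hA.derivCoeff i j).summable (y := y) hx).hasSum.mul_left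
      ((x : ℂ) ^ i * (y : ℂ) ^ j)).congr_fun fun p => ?_
    simp only [_root_.derivCoeff, Function.comp_apply, pow_add]
    ring
  · rintro ⟨m, n⟩ h
    rcases lt_or_ge m i with hm | hm
    · simp [Nat.descFactorial_eq_zero_iff_lt.2 hm]
    · rcases lt_or_ge n j with hn | hn
      · simp [Nat.descFactorial_eq_zero_iff_lt.2 hn]
      · exact absurd ⟨(m - i, n - j), by simp [hm, hn]⟩ h

theorem natCast_descFactorial_succ (n k : ℕ) :
    (n.descFactorial (k + 1) : ℂ) = ((n : ℂ) - k) * n.descFactorial k := by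
  rcases lt_or_ge n k with h | h
  · simp [Nat.descFactorial_eq_zero_iff_lt.2 h]
  · rw [Nat.descFactorial_succ, Nat.cast_mul, Nat.cast_sub h]

theorem poch_succ (a : ℂ) (n : ℕ) : poch a (n + 1) = poch a n * (a + n) :=
  Finset.prod_range_succ _ _

theorem poch_ne_zero {e : ℂ} (he : ∀ n : ℕ, e ≠ -(n : ℂ)) (n : ℕ) : poch e n ≠ 0 :=
  Finset.prod_ne_zero_iff.2 fun i _ h => he i (eq_neg_of_add_eq_zero_left h)

theorem poch_one (n : ℕ) : poch 1 n = (n.factorial : ℂ) := by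
  induction n with
  | zero => simp [poch]
  | succ n ih =>
    rw [poch_succ, ih, Nat.factorial_succ]
    push_cast
    ring

/-- Quotients of Pochhammer symbols grow subexponentially. -/
theorem exists_norm_poch_le (a : ℂ) {e : ℂ} (he : ∀ n : ℕ, e ≠ -(n : ℂ)) {q : ℝ} (hq : 1 < q) :
    ∃ C : ℝ, 0 ≤ C ∧ ∀ n, ‖poch a n‖ ≤ C * q ^ n * ‖poch e n‖ := by
  have hq0 : 0 < q := one_pos.trans hq
  obtain ⟨N, hN⟩ := exists_nat_gt ((‖a‖ + q * ‖e‖) / (q - 1))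
  have hstep : ∀ n : ℕ, N ≤ n → ‖a + n‖ ≤ q * ‖e + n‖ := by
    intro n hn
    rw [div_lt_iff₀ (by linarith)] at hN
    have hn' : (N : ℝ) ≤ n := by exact_mod_cast hn
    have h1 : ‖a + n‖ ≤ ‖a‖ + n := by simpa using norm_add_le a (n : ℂ)
    have h2 : (n : ℝ) - ‖e‖ ≤ ‖e + n‖ := by
      have := norm_sub_le (e + n) e
      simp only [add_sub_cancel_left, Complex.norm_natCast] at this
      linarith
    nlinarith
  have hpos : ∀ n, 0 < q ^ n * ‖poch e n‖ := fun n =>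
    mul_pos (pow_pos hq0 n) (norm_pos_iff.2 (poch_ne_zero he n))
  refine ⟨∑ k ∈ Finset.range (N + 1), ‖poch a k‖ / (q ^ k * ‖poch e k‖),
    Finset.sum_nonneg fun k _ => by positivity, fun n => ?_⟩
  have hsmall : ∀ n ≤ N, ‖poch a n‖ / (q ^ n * ‖poch e n‖) ≤
      ∑ k ∈ Finset.range (N + 1), ‖poch a k‖ / (q ^ k * ‖poch e k‖) := fun n hn =>
    Finset.single_le_sum (f := fun k => ‖poch a k‖ / (q ^ k * ‖poch e k‖))
      (fun k _ => by positivity) (Finset.mem_range.2 (Nat.lt_succ_of_le hn))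
  rcases le_total n N with hn | hn
  · rw [mul_assoc, ← div_le_iff₀ (hpos n)]
    exact hsmall n hn
  · induction n, hn using Nat.le_induction with
    | base =>
      rw [mul_assoc, ← div_le_iff₀ (hpos N)]
      exact hsmall N le_rfl
    | succ n hn ih =>
      rw [poch_succ, poch_succ, norm_mul, norm_mul]
      refine (mul_le_mul ih (hstep n hn) (norm_nonneg _) ((norm_nonneg _).trans ih)).trans_eq ?_
      ring

/-- The coefficients of the Kampé de Fériet function `F1`. -/
noncomputable def coeffF1 (a b c d e f g : ℂ) (p : ℕ × ℕ) : ℂ :=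
  poch a (p.1 + p.2) * poch b p.1 * poch c p.1 * poch d p.2 /
    (poch e (p.1 + p.2) * poch f (p.1 + p.2) * poch g p.2 *
      (Nat.factorial p.1 : ℂ) * (Nat.factorial p.2 : ℂ))

theorem one_ne_neg_natCast (n : ℕ) : (1 : ℂ) ≠ -(n : ℂ) := by
  intro h
  have h' : ((1 + n : ℕ) : ℂ) = 0 := by
    push_cast
    linear_combination h
  rw [Nat.cast_eq_zero] at h'
  omega

theorem exists_norm_coeffF1_le (a b c d : ℂ) {e f g : ℂ} (he : ∀ n : ℕ, e ≠ -(n : ℂ))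
    (hf : ∀ n : ℕ, f ≠ -(n : ℂ)) (hg : ∀ n : ℕ, g ≠ -(n : ℂ)) {q : ℝ} (hq : 1 < q) :
    ∃ C : ℝ, ∀ p : ℕ × ℕ,
      ‖coeffF1 a b c d e f g p‖ ≤ C * ((q ^ 4) ^ p.1 * ((q ^ 3) ^ p.2 / (p.2.factorial : ℝ))) := by
  have hq0 : 0 < q := one_pos.trans hq
  obtain ⟨C₁, h₁, hae⟩ := exists_norm_poch_le a he hq
  obtain ⟨C₂, h₂, hb⟩ := exists_norm_poch_le b one_ne_neg_natCast hq
  obtain ⟨C₃, h₃, hc⟩ := exists_norm_poch_le c one_ne_neg_natCast hq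
  obtain ⟨C₄, h₄, hdg⟩ := exists_norm_poch_le d hg hq
  obtain ⟨C₅, h₅, hf1⟩ := exists_norm_poch_le 1 hf hq
  refine ⟨C₁ * C₂ * C₃ * C₄ * C₅, fun ⟨m, n⟩ => ?_⟩
  have hcf : ‖poch c m‖ ≤ C₃ * q ^ m * (C₅ * q ^ (m + n) * ‖poch f (m + n)‖) := by
    refine (hc m).trans (mul_le_mul_of_nonneg_left (le_trans ?_ (hf1 (m + n))) (by positivity))
    rw [poch_one, poch_one, Complex.norm_natCast, Complex.norm_natCast]
    exact_mod_cast Nat.factorial_le (Nat.le_add_right m n)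
  have hb' := hb m
  rw [poch_one, Complex.norm_natCast] at hb'
  have hE := norm_pos_iff.2 (poch_ne_zero he (m + n))
  have hF := norm_pos_iff.2 (poch_ne_zero hf (m + n))
  have hG := norm_pos_iff.2 (poch_ne_zero hg n)
  have hm : (0 : ℝ) < m.factorial := by exact_mod_cast m.factorial_pos
  have hn : (0 : ℝ) < n.factorial := by exact_mod_cast n.factorial_pos
  simp only [coeffF1, norm_div, norm_mul, Complex.norm_natCast]
  rw [div_le_iff₀ (by positivity)]
  calc ‖poch a (m + n)‖ * ‖poch b m‖ * ‖poch c m‖ * ‖poch d n‖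
      ≤ (C₁ * q ^ (m + n) * ‖poch e (m + n)‖) * (C₂ * q ^ m * m.factorial) *
          (C₃ * q ^ m * (C₅ * q ^ (m + n) * ‖poch f (m + n)‖)) *
          (C₄ * q ^ n * ‖poch g n‖) := by
        gcongr
        · exact hae _
        · exact hdg _
    _ = _ := by
        field_simp
        ring

theorem stripSummable_coeffF1 (a b c d : ℂ) {e f g : ℂ} (he : ∀ n : ℕ, e ≠ -(n : ℂ))
    (hf : ∀ n : ℕ, f ≠ -(n : ℂ)) (hg : ∀ n : ℕ, g ≠ -(n : ℂ)) :
    StripSummable (coeffF1 a b c d e f g) := by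
  intro r R hr hr1 hR
  obtain ⟨q, hq, hqr⟩ : ∃ q : ℝ, 1 < q ∧ q ^ 4 * r < 1 := by
    have hcont : Tendsto (fun q : ℝ => q ^ 4 * r) (𝓝[>] 1) (𝓝 (1 ^ 4 * r)) :=
      ((continuous_id.pow 4).mul continuous_const).continuousAt.tendsto.mono_left
        nhdsWithin_le_nhds
    have hev := hcont.eventually (gt_mem_nhds (show (1 : ℝ) ^ 4 * r < 1 by simpa using hr1))
    obtain ⟨q, hq, hq1⟩ := (hev.and self_mem_nhdsWithin).exists
    exact ⟨q, hq1, hq⟩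
  have hq0 : 0 < q := one_pos.trans hq
  obtain ⟨C, hC⟩ := exists_norm_coeffF1_le a b c d he hf hg hq
  have hgeom := summable_geometric_of_lt_one (by positivity) hqr
  have hexp := Real.summable_pow_div_factorial (q ^ 3 * R)
  have hprod := hgeom.mul_of_nonneg hexp (fun m => by positivity) (fun n => by positivity)
  refine (hprod.mul_left C).of_nonneg_of_le (fun p => by positivity) fun p => ?_
  calc _ ≤ C * ((q ^ 4) ^ p.1 * ((q ^ 3) ^ p.2 / (p.2.factorial : ℝ))) * r ^ p.1 * R ^ p.2 := by
        gcongr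
        exact hC p
    _ = _ := by
        rw [mul_pow, mul_pow]
        ring

theorem coeffF1_succ_right (a b c d : ℂ) {e f g : ℂ} (he : ∀ n : ℕ, e ≠ -(n : ℂ))
    (hf : ∀ n : ℕ, f ≠ -(n : ℂ)) (hg : ∀ n : ℕ, g ≠ -(n : ℂ)) (m n : ℕ) :
    (n + 1) * (n + g) * (m + n + e) * (m + n + f) * coeffF1 a b c d e f g (m, n + 1) =
      (a + m + n) * (d + n) * coeffF1 a b c d e f g (m, n) := by
  have hE := poch_ne_zero he (m + n + 1)
  have hF := poch_ne_zero hf (m + n + 1)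
  have hG := poch_ne_zero hg (n + 1)
  have hm : (m.factorial : ℂ) ≠ 0 := by exact_mod_cast m.factorial_ne_zero
  have hn : (n.factorial : ℂ) ≠ 0 := by exact_mod_cast n.factorial_ne_zero
  have hn1 : (n + 1 : ℂ) ≠ 0 := by exact_mod_cast n.succ_ne_zero
  simp only [coeffF1, ← add_assoc, Nat.factorial_succ]
  rw [poch_succ] at hE hF hG
  simp only [poch_succ]
  obtain ⟨hE1, hE2⟩ := mul_ne_zero_iff.1 hE
  obtain ⟨hF1, hF2⟩ := mul_ne_zero_iff.1 hF
  obtain ⟨hG1, hG2⟩ := mul_ne_zero_iff.1 hG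
  push_cast at *
  field_simp
  ring

theorem stmt1 (a b c d e f g : ℂ)
    (he : ∀ n : ℕ, e ≠ -(n : ℂ)) (hf : ∀ n : ℕ, f ≠ -(n : ℂ)) (hg : ∀ n : ℕ, g ≠ -(n : ℂ))
    (u : ℝ → ℝ → ℂ)
    (hu : u = fun x y : ℝ => F1 a b c d e f g (x : ℂ) (y : ℂ)) :
    ∀ x y : ℝ, 0 < x → x < 1 → 0 < y →
      (y : ℂ) ^ 3 * pdy (pdy (pdy (pdy u))) x y
        + (x : ℂ) ^ 2 * (y : ℂ) * pdy (pdy (pdx (pdx u))) x y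
        + 2 * (x : ℂ) * (y : ℂ) ^ 2 * pdy (pdy (pdy (pdx u))) x y
        + (e + f + g + 3) * (y : ℂ) ^ 2 * pdy (pdy (pdy u)) x y
        + (e + f + 2 * g + 3) * (x : ℂ) * (y : ℂ) * pdy (pdy (pdx u)) x y
        + g * (x : ℂ) ^ 2 * pdy (pdx (pdx u)) x y
        + (((e + 1) * (f + 1) + (e + f + 1) * g) - (y : ℂ)) * (y : ℂ) * pdy (pdy u) x y
        + ((e + f + 1) * g - (y : ℂ)) * (x : ℂ) * pdy (pdx u) x y
        - d * (x : ℂ) * pdx u x y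
        + (e * f * g - (a + d + 1) * (y : ℂ)) * pdy u x y - a * d * u x y = 0 := by
  subst hu
  intro x y hx0 hx1 hy
  have hx : |x| < 1 := by rwa [abs_of_pos hx0]
  have hA := stripSummable_coeffF1 a b c d he hf hg
  set A := coeffF1 a b c d e f g with hAdef
  set u : ℝ → ℝ → ℂ := fun x y : ℝ => F1 a b c d e f g (x : ℂ) (y : ℂ)
  have h00 : ∀ x y, |x| < 1 → u x y = doubleSeries (derivCoeff 0 0 A) x y := by
    intro x y _
    rw [derivCoeff_zero_zero]
    rfl
  have h10 := pdx_eq_of_eq_doubleSeries hA h00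
  have h20 := pdx_eq_of_eq_doubleSeries hA h10
  have h01 := pdy_eq_of_eq_doubleSeries hA h00
  have h02 := pdy_eq_of_eq_doubleSeries hA h01
  have h03 := pdy_eq_of_eq_doubleSeries hA h02
  have h04 := pdy_eq_of_eq_doubleSeries hA h03
  have h11 := pdy_eq_of_eq_doubleSeries hA h10
  have h12 := pdy_eq_of_eq_doubleSeries hA h11
  have h13 := pdy_eq_of_eq_doubleSeries hA h12
  have h21 := pdy_eq_of_eq_doubleSeries hA h20
  have h22 := pdy_eq_of_eq_doubleSeries hA h21
  rw [h04 x y hx, h22 x y hx, h13 x y hx, h03 x y hx, h12 x y hx, h21 x y hx, h02 x y hx,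
    h11 x y hx, h10 x y hx, h01 x y hx, h00 x y hx]
  simp only [Nat.reduceAdd, zero_add]
  have hs := fun i j => hA.hasSum_descFactorial i j (y := y) hx
  have hleft := ((((((((hs 0 4).add (hs 2 2)).add ((hs 1 3).mul_left 2)).add
    ((hs 0 3).mul_left (e + f + g + 3))).add ((hs 1 2).mul_left (e + f + 2 * g + 3))).add
    ((hs 2 1).mul_left g)).add ((hs 0 2).mul_left ((e + 1) * (f + 1) + (e + f + 1) * g))).add
    ((hs 1 1).mul_left ((e + f + 1) * g))).add ((hs 0 1).mul_left (e * f * g))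
  have hright := (((((hs 0 2).add (hs 1 1)).add ((hs 1 0).mul_left d)).add
    ((hs 0 1).mul_left (a + d + 1))).add ((hs 0 0).mul_left (a * d))).mul_left (y : ℂ)
  have hinj : Function.Injective fun p : ℕ × ℕ => (p.1, p.2 + 1) := by
    rintro ⟨m, n⟩ ⟨m', n'⟩ h
    simpa using h
  rw [← hinj.hasSum_iff] at hleft
  · have heq := hleft.unique (hright.congr_fun ?_)
    · refine (mul_eq_zero.1 (?_ : (y : ℂ) * _ = 0)).resolve_left
        (Complex.ofReal_ne_zero.2 hy.ne')
      linear_combination heq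
    · rintro ⟨m, n⟩
      have hrec := coeffF1_succ_right a b c d he hf hg m n
      simp only [Function.comp_apply, natCast_descFactorial_succ, Nat.descFactorial_zero]
      push_cast
      rw [← hAdef] at hrec
      linear_combination (x : ℂ) ^ m * (y : ℂ) ^ (n + 1) * hrec
  · rintro ⟨m, n⟩ h
    rcases n with _ | n
    · simp [Nat.descFactorial]
    · exact absurd ⟨(m, n), rfl⟩ h
end

section
/- Let a, b, c, d, e, f, g ∈ ℂ with e, f, g, 1−g+e, 1−g+f, 2−g all not equal to a nonpositive integer. Then the function u(x,y) = y^{1−g} · F1(1−g+a, b, c, 1−g+d; 1−g+e, 1−g+f; 2−g; x, y), where y^{1−g} = exp((1−g)·log y) for y > 0, satisfies at every point of D = {(x,y) ∈ ℝ² : 0 < x < 1, 0 < y} the third-order partial differential equation x²(1−x)·u_xxx + xy(2−x)·u_xxy + y²·u_xyy + x[e+f+1−(a+b+c+3)x]·u_xx + y[e+f+1−(b+c+1)x]·u_xy + (ef − [a(b+c+1)+(b+1)(c+1)]x)·u_x − bcy·u_y − abc·u = 0. -/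
open Filter Topology

/-- A linear factor in `n` is absorbed by an arbitrarily small change of the ratio. -/
theorem exists_norm_add_natCast_mul_pow_le (k : ℂ) {r R : ℝ} (hr : 0 < r) (hrR : r < R) :
    ∃ C : ℝ, ∀ n : ℕ, ‖k + n‖ * r ^ n ≤ C * R ^ n := by
  have hR : 0 < R := hr.trans hrR
  have hq : ‖r / R‖ < 1 := by
    rw [Real.norm_of_nonneg (by positivity), div_lt_one hR]
    exact hrR
  have h1 := summable_pow_mul_geometric_of_norm_lt_one 1 hq
  have h2 := summable_pow_mul_geometric_of_norm_lt_one 0 hq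
  have h := (h2.mul_left ‖k‖).add h1
  refine ⟨∑' n : ℕ, (‖k‖ * ((n : ℝ) ^ 0 * (r / R) ^ n) + (n : ℝ) ^ 1 * (r / R) ^ n), fun n => ?_⟩
  have hle := h.le_tsum n (fun j _ => by positivity)
  have hk : ‖k + n‖ ≤ ‖k‖ + n := by
    simpa using norm_add_le k (n : ℂ)
  calc ‖k + n‖ * r ^ n ≤ (‖k‖ + n) * r ^ n := by gcongr
    _ = (‖k‖ * ((n : ℝ) ^ 0 * (r / R) ^ n) + (n : ℝ) ^ 1 * (r / R) ^ n) * R ^ n := by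
        rw [div_pow]
        field_simp
    _ ≤ _ := by gcongr

theorem summable_norm_add_natCast_mul {ι : Type*} (k : ℂ) (c : ι → ℂ) (w : ι → ℕ) {r R : ℝ}
    (hr : 0 < r) (hrR : r < R) (hc : Summable fun i => ‖c i‖ * R ^ w i) :
    Summable fun i => ‖(k + w i) * c i‖ * r ^ w i := by
  obtain ⟨C, hC⟩ := exists_norm_add_natCast_mul_pow_le k hr hrR
  refine Summable.of_nonneg_of_le (fun i => by positivity) (fun i => ?_) (hc.mul_left C)
  calc ‖(k + w i) * c i‖ * r ^ w i = ‖c i‖ * (‖k + w i‖ * r ^ w i) := by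
        rw [norm_mul]; ring
    _ ≤ ‖c i‖ * (C * R ^ w i) := mul_le_mul_of_nonneg_left (hC _) (norm_nonneg _)
    _ = _ := by ring

theorem cexp_sub_one_mul_log (k : ℂ) {t : ℝ} (ht : 0 < t) :
    Complex.exp ((k - 1) * Real.log t) = Complex.exp (k * Real.log t) / t := by
  rw [sub_mul, one_mul, Complex.exp_sub, ← Complex.ofReal_exp, Real.exp_log ht]

/-- Termwise differentiation of a power series times a complex power. -/
theorem hasDerivAt_cpow_mul_tsum {ι : Type*} (k : ℂ) (c : ι → ℂ) (w : ι → ℕ) {t R : ℝ}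
    (ht : 0 < t) (htR : t < R) (hc : Summable fun i => ‖c i‖ * R ^ w i) :
    HasDerivAt (fun z : ℝ => Complex.exp (k * Real.log z) * ∑' i, c i * (z : ℂ) ^ w i)
      (Complex.exp ((k - 1) * Real.log t) * ∑' i, (k + w i) * c i * (t : ℂ) ^ w i) t := by
  obtain ⟨r, htr, hrR⟩ := exists_between htR
  have hr : 0 < r := ht.trans htr
  have htC : (t : ℂ) ≠ 0 := by exact_mod_cast ht.ne'
  have hsumt : Summable fun i => c i * (t : ℂ) ^ w i := by
    refine Summable.of_norm_bounded hc fun i => ?_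
    rw [norm_mul, norm_pow, Complex.norm_real, Real.norm_of_nonneg ht.le]
    gcongr
  have hsumd : Summable fun i => (w i : ℂ) * c i * (t : ℂ) ^ w i := by
    refine Summable.of_norm_bounded
      (summable_norm_add_natCast_mul 0 c w ht htR hc) fun i => ?_
    simp [abs_of_pos ht]
  have hser : HasDerivAt (fun z : ℝ => ∑' i, c i * (z : ℂ) ^ w i)
      (∑' i, c i * (w i * (t : ℂ) ^ (w i - 1))) t := by
    have hb := (summable_norm_add_natCast_mul 0 c w hr hrR hc).mul_left (2 / t)
    have hmem : t ∈ Set.Ioo (t / 2) r := ⟨by linarith, htr⟩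
    refine hasDerivAt_tsum_of_isPreconnected (g := fun i (z : ℝ) => c i * (z : ℂ) ^ w i)
      (g' := fun i (z : ℝ) => c i * (w i * (z : ℂ) ^ (w i - 1))) hb isOpen_Ioo
      isPreconnected_Ioo (fun i z _ => ?_) (fun i z hz => ?_) hmem hsumt hmem
    · have := ((hasDerivAt_pow (w i) (z : ℂ)).comp_ofReal).const_mul (c i)
      simpa using this
    · have hz0 : 0 < z := by linarith [hz.1]
      rcases Nat.eq_zero_or_pos (w i) with h0 | hpos
      · simp [h0]
      · have hzp : z ^ (w i - 1) ≤ 2 / t * r ^ w i := by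
          calc z ^ (w i - 1) = z⁻¹ * z ^ w i := by
                rw [← Nat.sub_add_cancel hpos, pow_succ]
                field_simp
                simp
            _ ≤ (t / 2)⁻¹ * r ^ w i := by
                gcongr
                · exact hz.1.le
                · exact hz.2.le
            _ = _ := by rw [inv_div]
        simp only [norm_mul, norm_pow, Complex.norm_real, Complex.norm_natCast,
          Real.norm_of_nonneg hz0.le, zero_add]
        calc ‖c i‖ * (w i * z ^ (w i - 1)) ≤ ‖c i‖ * (w i * (2 / t * r ^ w i)) := by gcongr
          _ = _ := by ring
  have hpow : HasDerivAt (fun z : ℝ => Complex.exp (k * Real.log z))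
      (Complex.exp (k * Real.log t) * (k * ((t⁻¹ : ℝ) : ℂ))) t :=
    (((Real.hasDerivAt_log ht.ne').ofReal_comp).const_mul k).cexp
  have hw : (∑' i, c i * (w i * (t : ℂ) ^ (w i - 1)))
      = (t : ℂ)⁻¹ * ∑' i, (w i : ℂ) * c i * (t : ℂ) ^ w i := by
    rw [← tsum_mul_left]
    refine tsum_congr fun i => ?_
    rcases Nat.eq_zero_or_pos (w i) with h0 | hpos
    · simp [h0]
    · obtain ⟨j, hj⟩ := Nat.exists_eq_add_of_lt hpos
      rw [hj]
      simp only [zero_add, Nat.add_sub_cancel, pow_succ]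
      field_simp
  have hsplit : (∑' i, (k + w i) * c i * (t : ℂ) ^ w i)
      = k * (∑' i, c i * (t : ℂ) ^ w i) + ∑' i, (w i : ℂ) * c i * (t : ℂ) ^ w i := by
    rw [← tsum_mul_left, ← (hsumt.mul_left k).tsum_add hsumd]
    exact tsum_congr fun i => by ring
  refine (hpow.mul hser).congr_deriv ?_
  rw [cexp_sub_one_mul_log k ht, hw, hsplit]
  push_cast
  field_simp

/-- Coefficient arrays whose double power series converges absolutely for `0 < x < 1`, `0 < y`. -/
def SummableOnStrip (A : ℕ × ℕ → ℂ) : Prop :=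
  ∀ x y : ℝ, 0 < x → x < 1 → 0 < y → Summable fun p => ‖A p‖ * x ^ p.1 * y ^ p.2

/-- The series `x ^ k * y ^ s * ∑ A (m, n) * x ^ m * y ^ n` with complex exponents `k`, `s`. -/
noncomputable def powSeries (k s : ℂ) (A : ℕ × ℕ → ℂ) (x y : ℝ) : ℂ :=
  Complex.exp (k * Real.log x) * (Complex.exp (s * Real.log y) *
    ∑' p : ℕ × ℕ, A p * (x : ℂ) ^ p.1 * (y : ℂ) ^ p.2)

/-- Equality of two functions on the strip `0 < x < 1`, `0 < y`. -/
def EqOnStrip (u v : ℝ → ℝ → ℂ) : Prop :=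
  ∀ x y : ℝ, 0 < x → x < 1 → 0 < y → u x y = v x y

theorem SummableOnStrip.mul_fst {A : ℕ × ℕ → ℂ} (hA : SummableOnStrip A) (k : ℂ) :
    SummableOnStrip fun p => (k + p.1) * A p := by
  intro x y hx hx1 hy
  obtain ⟨r, hxr, hr1⟩ := exists_between hx1
  have h := summable_norm_add_natCast_mul k (fun p => A p * (y : ℂ) ^ p.2) Prod.fst hx hxr
    ((hA r y (hx.trans hxr) hr1 hy).congr fun p => by
      simp [abs_of_pos hy]; ring)
  refine h.congr fun p => ?_
  simp [abs_of_pos hy]; ring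

theorem SummableOnStrip.mul_snd {A : ℕ × ℕ → ℂ} (hA : SummableOnStrip A) (s : ℂ) :
    SummableOnStrip fun p => (s + p.2) * A p := by
  intro x y hx hx1 hy
  have h := summable_norm_add_natCast_mul s (fun p => A p * (x : ℂ) ^ p.1) Prod.snd hy
    (lt_add_one y) ((hA x (y + 1) hx hx1 (by linarith)).congr fun p => by
      simp [abs_of_pos hx])
  refine h.congr fun p => ?_
  simp only [norm_mul, norm_pow, Complex.norm_real, Real.norm_of_nonneg hx.le]
  ring

theorem EqOnStrip.exists_hasSum {u : ℝ → ℝ → ℂ} {k s : ℂ} {A : ℕ × ℕ → ℂ}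
    (hu : EqOnStrip u (powSeries k s A)) (hA : SummableOnStrip A) {x y : ℝ}
    (hx : 0 < x) (hx1 : x < 1) (hy : 0 < y) :
    ∃ S : ℂ, HasSum (fun p : ℕ × ℕ => A p * (x : ℂ) ^ p.1 * (y : ℂ) ^ p.2) S ∧
      u x y = Complex.exp (k * Real.log x) * (Complex.exp (s * Real.log y) * S) := by
  refine ⟨_, (Summable.of_norm_bounded (hA x y hx hx1 hy) fun p => ?_).hasSum,
    hu x y hx hx1 hy⟩
  simp [abs_of_pos hx, abs_of_pos hy]

theorem EqOnStrip.pdx_powSeries {u : ℝ → ℝ → ℂ} {k s : ℂ} {A : ℕ × ℕ → ℂ}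
    (hA : SummableOnStrip A) (hu : EqOnStrip u (powSeries k s A)) :
    EqOnStrip (pdx u) (powSeries (k - 1) s fun p => (k + p.1) * A p) := by
  intro x y hx hx1 hy
  obtain ⟨r, hxr, hr1⟩ := exists_between hx1
  have h := (hasDerivAt_cpow_mul_tsum k (fun p => A p * (y : ℂ) ^ p.2) Prod.fst hx hxr
    ((hA r y (hx.trans hxr) hr1 hy).congr fun p => by
      simp [abs_of_pos hy]; ring)).mul_const (Complex.exp (s * Real.log y))
  have hev : (fun t : ℝ => u t y) =ᶠ[𝓝 x] fun z : ℝ =>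
      (Complex.exp (k * Real.log z) * ∑' p : ℕ × ℕ, A p * (y : ℂ) ^ p.2 * (z : ℂ) ^ p.1)
        * Complex.exp (s * Real.log y) := by
    filter_upwards [Ioo_mem_nhds hx hx1] with z hz
    rw [hu z y hz.1 hz.2 hy, powSeries, mul_assoc, mul_comm (tsum _)]
    simp only [mul_right_comm]
  refine (h.congr_of_eventuallyEq hev).deriv.trans ?_
  rw [powSeries, mul_assoc, mul_comm (tsum _)]
  congr 3
  funext p
  ring

theorem EqOnStrip.pdy_powSeries {u : ℝ → ℝ → ℂ} {k s : ℂ} {A : ℕ × ℕ → ℂ}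
    (hA : SummableOnStrip A) (hu : EqOnStrip u (powSeries k s A)) :
    EqOnStrip (pdy u) (powSeries k (s - 1) fun p => (s + p.2) * A p) := by
  intro x y hx hx1 hy
  have h := (hasDerivAt_cpow_mul_tsum s (fun p => A p * (x : ℂ) ^ p.1) Prod.snd hy
    (lt_add_one y) ((hA x (y + 1) hx hx1 (by linarith)).congr fun p => by
      simp [abs_of_pos hx])).const_mul (Complex.exp (k * Real.log x))
  have hev : (fun t : ℝ => u x t) =ᶠ[𝓝 y] fun z : ℝ => Complex.exp (k * Real.log x) *
      (Complex.exp (s * Real.log z) * ∑' p : ℕ × ℕ, A p * (x : ℂ) ^ p.1 * (z : ℂ) ^ p.2) := by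
    filter_upwards [Ioi_mem_nhds hy] with z hz
    rw [hu x z hx hx1 hz, powSeries]
  refine (h.congr_of_eventuallyEq hev).deriv.trans ?_
  rw [powSeries]
  congr 3
  funext p
  ring

/-- Quotients of Pochhammer symbols grow subexponentially. -/
theorem exists_norm_poch_div_poch_le (a e : ℂ) {ρ : ℝ} (hρ : 1 < ρ) :
    ∃ C : ℝ, 0 ≤ C ∧ ∀ n : ℕ, ‖poch a n / poch e n‖ ≤ C * ρ ^ n := by
  obtain ⟨N, hN⟩ := exists_nat_gt ((‖a‖ + ρ * ‖e‖) / (ρ - 1))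
  have hρ1 : 0 < ρ - 1 := by linarith
  rw [div_lt_iff₀ hρ1] at hN
  have hstep : ∀ n : ℕ, N ≤ n → ‖(a + n) / (e + n)‖ ≤ ρ := by
    intro n hn
    have hn' : (N : ℝ) ≤ n := by exact_mod_cast hn
    have h1 : ‖a + n‖ ≤ ‖a‖ + n := by simpa using norm_add_le a (n : ℂ)
    have h2 : (n : ℝ) - ‖e‖ ≤ ‖e + n‖ := by
      have := norm_sub_norm_le (n : ℂ) (-e)
      simpa [add_comm] using this
    rw [norm_div]
    refine div_le_of_le_mul₀ (norm_nonneg _) (by linarith) ?_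
    nlinarith [mul_le_mul_of_nonneg_right hn' hρ1.le]
  set C := ∑ n ∈ Finset.range (N + 1), ‖poch a n / poch e n‖ with hCdef
  have hC : 0 ≤ C := Finset.sum_nonneg fun _ _ => norm_nonneg _
  refine ⟨C, hC, fun n => ?_⟩
  have hsmall : ∀ n ≤ N, ‖poch a n / poch e n‖ ≤ C * ρ ^ n := fun n hn =>
    (Finset.single_le_sum (f := fun n => ‖poch a n / poch e n‖) (fun _ _ => norm_nonneg _)
      (Finset.mem_range.2 (Nat.lt_succ_of_le hn))).trans
      (le_mul_of_one_le_right hC (one_le_pow₀ hρ.le))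
  rcases le_total n N with hn | hn
  · exact hsmall n hn
  · induction n, hn using Nat.le_induction with
    | base => exact hsmall N le_rfl
    | succ n hn ih =>
      rw [poch_succ, poch_succ, mul_div_mul_comm, norm_mul, pow_succ, ← mul_assoc]
      exact mul_le_mul ih (hstep n hn) (norm_nonneg _) (by positivity)

/-- The coefficients of the double series `F1`. -/
noncomputable def kampeCoeff (a b c d e f g : ℂ) (p : ℕ × ℕ) : ℂ :=
  poch a (p.1 + p.2) * poch b p.1 * poch c p.1 * poch d p.2 /
    (poch e (p.1 + p.2) * poch f (p.1 + p.2) * poch g p.2 *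
      (Nat.factorial p.1 : ℂ) * (Nat.factorial p.2 : ℂ))

theorem summableOnStrip_kampeCoeff (a b c d e f g : ℂ) :
    SummableOnStrip (kampeCoeff a b c d e f g) := by
  intro x y hx hx1 hy
  obtain ⟨ρ, hρx, hρ⟩ : ∃ ρ : ℝ, ρ ^ 4 * x < 1 ∧ 1 < ρ := by
    have hcont : Tendsto (fun ρ : ℝ => ρ ^ 4 * x) (𝓝[>] 1) (𝓝 (1 ^ 4 * x)) :=
      (Continuous.tendsto (by fun_prop) 1).mono_left nhdsWithin_le_nhds
    exact ((hcont.eventually_lt_const (by simpa using hx1)).and self_mem_nhdsWithin).exists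
  have hρ0 : 0 < ρ := by linarith
  obtain ⟨C₁, hC₁, h₁⟩ := exists_norm_poch_div_poch_le a e hρ
  obtain ⟨C₂, hC₂, h₂⟩ := exists_norm_poch_div_poch_le 1 f hρ
  obtain ⟨C₃, hC₃, h₃⟩ := exists_norm_poch_div_poch_le b 1 hρ
  obtain ⟨C₄, hC₄, h₄⟩ := exists_norm_poch_div_poch_le c 1 hρ
  obtain ⟨C₅, hC₅, h₅⟩ := exists_norm_poch_div_poch_le d g hρ
  have hs := ((summable_geometric_of_lt_one (by positivity) hρx).mul_of_nonneg
    (Real.summable_pow_div_factorial (ρ ^ 3 * y)) (fun _ => by positivity)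
    (fun _ => by positivity)).mul_left (C₁ * C₂ * C₃ * C₄ * C₅)
  refine Summable.of_nonneg_of_le (fun p => by positivity) (fun p => ?_) hs
  obtain ⟨m, n⟩ := p
  have hfac : ∀ j : ℕ, (j.factorial : ℂ) ≠ 0 := fun j => by exact_mod_cast j.factorial_ne_zero
  have heq : kampeCoeff a b c d e f g (m, n)
      = (poch a (m + n) / poch e (m + n)) * (poch 1 (m + n) / poch f (m + n))
        * (poch b m / poch 1 m) * (poch c m / poch 1 m) * (poch d n / poch g n)
        * (m.factorial / (m + n).factorial) / n.factorial := by
    have := hfac m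
    have := hfac n
    have := hfac (m + n)
    simp only [kampeCoeff, poch_one, div_eq_mul_inv, mul_inv]
    field_simp
  have hquot : ‖(m.factorial / (m + n).factorial : ℂ)‖ ≤ 1 := by
    rw [norm_div, Complex.norm_natCast, Complex.norm_natCast]
    exact div_le_one_of_le₀ (by exact_mod_cast Nat.factorial_le (Nat.le_add_right m n))
      (by positivity)
  rw [heq, norm_div, Complex.norm_natCast]
  simp only [norm_mul]
  calc _ ≤ (C₁ * ρ ^ (m + n)) * (C₂ * ρ ^ (m + n)) * (C₃ * ρ ^ m) * (C₄ * ρ ^ m)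
        * (C₅ * ρ ^ n) * 1 / n.factorial * x ^ m * y ^ n := by
        gcongr
        · exact h₁ _
        · exact h₂ _
        · exact h₃ _
        · exact h₄ _
        · exact h₅ _
    _ = _ := by ring

theorem kampeCoeff_succ_fst (a b c d : ℂ) {e f : ℂ} (g : ℂ) (he : ∀ n : ℕ, e ≠ -(n : ℂ))
    (hf : ∀ n : ℕ, f ≠ -(n : ℂ)) (m n : ℕ) :
    ((m : ℂ) + 1) * (e + m + n) * (f + m + n) * kampeCoeff a b c d e f g (m + 1, n)
      = (a + m + n) * (b + m) * (c + m) * kampeCoeff a b c d e f g (m, n) := by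
  have h1 : e + (m + n : ℕ) ≠ 0 := fun h => he (m + n) (eq_neg_of_add_eq_zero_left h)
  have h2 : f + (m + n : ℕ) ≠ 0 := fun h => hf (m + n) (eq_neg_of_add_eq_zero_left h)
  have h3 : ((m + 1 : ℕ) : ℂ) ≠ 0 := by exact_mod_cast m.succ_ne_zero
  have hrec : kampeCoeff a b c d e f g (m + 1, n)
      = (a + (m + n : ℕ)) * (b + m) * (c + m) * kampeCoeff a b c d e f g (m, n) /
        ((m + 1 : ℕ) * (e + (m + n : ℕ)) * (f + (m + n : ℕ))) := by
    simp only [kampeCoeff, Nat.add_right_comm m 1 n, poch_succ, Nat.factorial_succ]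
    rw [mul_div_assoc', div_div]
    congr 1 <;> push_cast <;> ring
  rw [hrec, mul_div_assoc', div_eq_iff (mul_ne_zero (mul_ne_zero h3 h1) h2)]
  push_cast
  ring

theorem hasSum_comp_succ_fst {T : ℕ × ℕ → ℂ} {t : ℂ} (hT : HasSum T t)
    (h0 : ∀ n, T (0, n) = 0) : HasSum (fun p : ℕ × ℕ => T (p.1 + 1, p.2)) t := by
  have hinj : Function.Injective fun p : ℕ × ℕ => (p.1 + 1, p.2) := by
    rintro ⟨m, n⟩ ⟨m', n'⟩ h
    simpa using h
  refine (hinj.hasSum_iff ?_).2 hT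
  rintro ⟨m, n⟩ hmn
  cases m with
  | zero => exact h0 n
  | succ m => exact absurd ⟨(m, n), rfl⟩ hmn

theorem stmt2 (a b c d e f g : ℂ)
    (he : ∀ n : ℕ, e ≠ -(n : ℂ)) (hf : ∀ n : ℕ, f ≠ -(n : ℂ)) (hg : ∀ n : ℕ, g ≠ -(n : ℂ))
    (he' : ∀ n : ℕ, (1 - g + e) ≠ -(n : ℂ)) (hf' : ∀ n : ℕ, (1 - g + f) ≠ -(n : ℂ)) (hg' : ∀ n : ℕ, (2 - g) ≠ -(n : ℂ))
    (u : ℝ → ℝ → ℂ)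
    (hu : u = fun x y : ℝ => Complex.exp ((1 - g) * (Real.log y : ℂ)) * F1 (1 - g + a) b c (1 - g + d) (1 - g + e) (1 - g + f) (2 - g) (x : ℂ) (y : ℂ)) :
    ∀ x y : ℝ, 0 < x → x < 1 → 0 < y →
      (x : ℂ) ^ 2 * (1 - (x : ℂ)) * pdx (pdx (pdx u)) x y
        + (x : ℂ) * (y : ℂ) * (2 - (x : ℂ)) * pdy (pdx (pdx u)) x y
        + (y : ℂ) ^ 2 * pdy (pdy (pdx u)) x y
        + (x : ℂ) * (e + f + 1 - (a + b + c + 3) * (x : ℂ)) * pdx (pdx u) x y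
        + (y : ℂ) * (e + f + 1 - (b + c + 1) * (x : ℂ)) * pdy (pdx u) x y
        + (e * f - (a * (b + c + 1) + (b + 1) * (c + 1)) * (x : ℂ)) * pdx u x y
        - b * c * (y : ℂ) * pdy u x y - a * b * c * u x y = 0 := by
  intro x y hx hx1 hy
  set A := kampeCoeff (1 - g + a) b c (1 - g + d) (1 - g + e) (1 - g + f) (2 - g) with hAdef
  have hA : SummableOnStrip A := summableOnStrip_kampeCoeff _ _ _ _ _ _ _
  have h : EqOnStrip u (powSeries 0 (1 - g) A) := by
    intro x y _ _ _
    simp only [hu, powSeries, F1, zero_mul, Complex.exp_zero, one_mul, hAdef, kampeCoeff]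
  have Ax := hA.mul_fst 0
  have Axx := Ax.mul_fst (0 - 1)
  have hX := h.pdx_powSeries hA
  have hXX := hX.pdx_powSeries Ax
  have hXXX := hXX.pdx_powSeries Axx
  have hXXY := hXX.pdy_powSeries Axx
  have hXY := hX.pdy_powSeries Ax
  have hXYY := hXY.pdy_powSeries (Ax.mul_snd (1 - g))
  have hY := h.pdy_powSeries hA
  obtain ⟨SXXX, sXXX, eXXX⟩ := hXXX.exists_hasSum (Axx.mul_fst (0 - 1 - 1)) hx hx1 hy
  obtain ⟨SXXY, sXXY, eXXY⟩ := hXXY.exists_hasSum (Axx.mul_snd (1 - g)) hx hx1 hy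
  obtain ⟨SXYY, sXYY, eXYY⟩ :=
    hXYY.exists_hasSum ((Ax.mul_snd (1 - g)).mul_snd (1 - g - 1)) hx hx1 hy
  obtain ⟨SXX, sXX, eXX⟩ := hXX.exists_hasSum Axx hx hx1 hy
  obtain ⟨SXY, sXY, eXY⟩ := hXY.exists_hasSum (Ax.mul_snd (1 - g)) hx hx1 hy
  obtain ⟨SX, sX, eX⟩ := hX.exists_hasSum Ax hx hx1 hy
  obtain ⟨SY, sY, eY⟩ := hY.exists_hasSum (hA.mul_snd (1 - g)) hx hx1 hy
  obtain ⟨SU, sU, eU⟩ := h.exists_hasSum hA hx hx1 hy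
  rw [eXXX, eXXY, eXYY, eXX, eXY, eX, eY, eU]
  simp only [cexp_sub_one_mul_log _ hx, cexp_sub_one_mul_log _ hy]
  have hT := (((((sXXX.add (sXXY.mul_left 2)).add sXYY).add (sXX.mul_left (e + f + 1))).add
    (sXY.mul_left (e + f + 1))).add (sX.mul_left (e * f)))
  have hQ := ((((((sXXX.add sXXY).add (sXX.mul_left (a + b + c + 3))).add
    (sXY.mul_left (b + c + 1))).add
    (sX.mul_left (a * (b + c + 1) + (b + 1) * (c + 1)))).add (sY.mul_left (b * c))).add
    (sU.mul_left (a * b * c))).mul_left (x : ℂ)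
  have hS := hasSum_comp_succ_fst hT (fun n => by simp)
  have key := hS.unique (hQ.congr_fun fun p => ?_)
  · have hx0 : (x : ℂ) ≠ 0 := by exact_mod_cast hx.ne'
    have hy0 : (y : ℂ) ≠ 0 := by exact_mod_cast hy.ne'
    simp only [zero_mul, Complex.exp_zero]
    field_simp
    linear_combination Complex.exp ((1 - g) * Real.log y) * key
  · have hrec := kampeCoeff_succ_fst (1 - g + a) b c (1 - g + d) (2 - g) he' hf' p.1 p.2
    rw [← hAdef] at hrec
    push_cast
    linear_combination (x : ℂ) ^ (p.1 + 1) * (y : ℂ) ^ p.2 * hrec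
end

section
/- Let b, c, d, e, g ∈ ℂ with e and g not equal to a nonpositive integer. Then the function u(x,y) = F2(b,c,d;e;g;x,y) satisfies, at every point of D = {(x,y) ∈ ℝ² : 0 < x < 1, 0 < y}, the second-order partial differential equation x(1−x)·u_xx + y·u_xy + [e − (b+c+1)x]·u_x − bc·u = 0. -/
/-- Kampé de Fériet function of the third order. -/
noncomputable def F2 (b c d e g x y : ℂ) : ℂ :=
  ∑' p : ℕ × ℕ,
    poch b p.1 * poch c p.1 * poch d p.2 /
      (poch e (p.1 + p.2) * poch g p.2 * (Nat.factorial p.1 : ℂ) * (Nat.factorial p.2 : ℂ)) *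
      x ^ p.1 * y ^ p.2

namespace KampeDeFeriet

open Filter

/-- The coefficients of the series defining `F2`. -/
noncomputable def coeff (b c d e g : ℂ) (p : ℕ × ℕ) : ℂ :=
  poch b p.1 * poch c p.1 * poch d p.2 /
    (poch e (p.1 + p.2) * poch g p.2 * (Nat.factorial p.1 : ℂ) * (Nat.factorial p.2 : ℂ))

/-- The sum of the double power series with coefficients `a`. -/
noncomputable def doubleSum (a : ℕ × ℕ → ℂ) (x y : ℂ) : ℂ := ∑' p, a p * x ^ p.1 * y ^ p.2

/-- The terms of the double power series are bounded on every polydisc of radii `r < 1` and `s`. -/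
def TermsBounded (a : ℕ × ℕ → ℂ) : Prop :=
  ∀ r s : ℝ, 0 < r → r < 1 → 0 < s → ∃ C, ∀ p, ‖a p‖ * r ^ p.1 * s ^ p.2 ≤ C

/-- The coefficients of the derivative in the first variable. -/
def derivFst (a : ℕ × ℕ → ℂ) (p : ℕ × ℕ) : ℂ := (p.1 + 1) * a (p.1 + 1, p.2)

/-- The coefficients of the derivative in the second variable. -/
def derivSnd (a : ℕ × ℕ → ℂ) (p : ℕ × ℕ) : ℂ := (p.2 + 1) * a (p.1, p.2 + 1)

lemma exists_nat_mul_pow_le {r t : ℝ} (hr : 0 < r) (hrt : r < t) :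
    ∃ K, 0 ≤ K ∧ ∀ m : ℕ, m * r ^ m ≤ K * t ^ m := by
  have ht : 0 < t := hr.trans hrt
  obtain ⟨K, hK⟩ := (tendsto_self_mul_const_pow_of_lt_one (div_pos hr ht).le
    ((div_lt_one ht).2 hrt)).bddAbove_range
  have hK' : ∀ m : ℕ, m * (r / t) ^ m ≤ K := fun m => hK ⟨m, rfl⟩
  refine ⟨K, by simpa using hK' 0, fun m => ?_⟩
  have h := hK' m
  rwa [div_pow, ← mul_div_assoc, div_le_iff₀ (by positivity)] at h

lemma TermsBounded.natCast_fst_mul {a : ℕ × ℕ → ℂ} (ha : TermsBounded a) :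
    TermsBounded fun p => p.1 * a p := by
  intro r s hr hr1 hs
  obtain ⟨t, hrt, ht1⟩ := exists_between hr1
  obtain ⟨K, hK0, hK⟩ := exists_nat_mul_pow_le hr hrt
  obtain ⟨C, hC⟩ := ha t s (hr.trans hrt) ht1 hs
  refine ⟨K * C, fun p => ?_⟩
  calc ‖(p.1 : ℂ) * a p‖ * r ^ p.1 * s ^ p.2 = (p.1 * r ^ p.1) * (‖a p‖ * s ^ p.2) := by
        rw [norm_mul, Complex.norm_natCast]; ring
    _ ≤ (K * t ^ p.1) * (‖a p‖ * s ^ p.2) :=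
        mul_le_mul_of_nonneg_right (hK _) (by positivity)
    _ = K * (‖a p‖ * t ^ p.1 * s ^ p.2) := by ring
    _ ≤ K * C := by gcongr; exact hC p

lemma TermsBounded.natCast_snd_mul {a : ℕ × ℕ → ℂ} (ha : TermsBounded a) :
    TermsBounded fun p => p.2 * a p := by
  intro r s hr hr1 hs
  obtain ⟨K, hK0, hK⟩ := exists_nat_mul_pow_le hs (lt_add_one s)
  obtain ⟨C, hC⟩ := ha r (s + 1) hr hr1 (by positivity)
  refine ⟨K * C, fun p => ?_⟩
  calc ‖(p.2 : ℂ) * a p‖ * r ^ p.1 * s ^ p.2 = (p.2 * s ^ p.2) * (‖a p‖ * r ^ p.1) := by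
        rw [norm_mul, Complex.norm_natCast]; ring
    _ ≤ (K * (s + 1) ^ p.2) * (‖a p‖ * r ^ p.1) :=
        mul_le_mul_of_nonneg_right (hK _) (by positivity)
    _ = K * (‖a p‖ * r ^ p.1 * (s + 1) ^ p.2) := by ring
    _ ≤ K * C := by gcongr; exact hC p

lemma TermsBounded.derivFst {a : ℕ × ℕ → ℂ} (ha : TermsBounded a) :
    TermsBounded (derivFst a) := by
  intro r s hr hr1 hs
  obtain ⟨C, hC⟩ := ha.natCast_fst_mul r s hr hr1 hs
  refine ⟨C / r, fun p => ?_⟩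
  rw [le_div_iff₀ hr]
  have h := hC (p.1 + 1, p.2)
  simp only [Nat.cast_add, Nat.cast_one] at h
  calc _ = _ := by simp only [KampeDeFeriet.derivFst]; ring
    _ ≤ C := h

lemma TermsBounded.summable_norm {a : ℕ × ℕ → ℂ} (ha : TermsBounded a) {r s : ℝ}
    (hr : 0 < r) (hr1 : r < 1) (hs : 0 < s) :
    Summable fun p : ℕ × ℕ => ‖a p‖ * r ^ p.1 * s ^ p.2 := by
  obtain ⟨t, hrt, ht1⟩ := exists_between hr1
  have ht : 0 < t := hr.trans hrt
  obtain ⟨C, hC⟩ := ha t (s + 1) ht ht1 (by positivity)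
  have hgeom : Summable fun p : ℕ × ℕ => (r / t) ^ p.1 * (s / (s + 1)) ^ p.2 :=
    (summable_geometric_of_lt_one (by positivity) ((div_lt_one ht).2 hrt)).mul_of_nonneg
      (summable_geometric_of_lt_one (by positivity)
        ((div_lt_one (by positivity)).2 (lt_add_one s)))
      (fun _ => by positivity) (fun _ => by positivity)
  refine Summable.of_nonneg_of_le (fun p => by positivity) (fun p => ?_) (hgeom.mul_left C)
  calc ‖a p‖ * r ^ p.1 * s ^ p.2
      = (‖a p‖ * t ^ p.1 * (s + 1) ^ p.2) * ((r / t) ^ p.1 * (s / (s + 1)) ^ p.2) := by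
        rw [div_pow, div_pow]; field_simp
    _ ≤ _ := by gcongr; exact hC p

lemma TermsBounded.summable {a : ℕ × ℕ → ℂ} (ha : TermsBounded a) {x y : ℂ} (hx : ‖x‖ < 1) :
    Summable fun p : ℕ × ℕ => a p * x ^ p.1 * y ^ p.2 := by
  obtain ⟨r, hxr, hr1⟩ := exists_between hx
  have hr : 0 < r := (norm_nonneg x).trans_lt hxr
  refine Summable.of_norm_bounded (ha.summable_norm hr hr1
    (by positivity : 0 < ‖y‖ + 1)) fun p => ?_
  rw [norm_mul, norm_mul, norm_pow, norm_pow]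
  gcongr
  exact (lt_add_one _).le

lemma hasDerivAt_tsum_mul_pow {ι : Type*} (c : ι → ℂ) (k : ι → ℕ) {r : ℝ} {x : ℂ}
    (hx : ‖x‖ < r) (h : Summable fun i => ‖c i‖ * r ^ k i)
    (h' : Summable fun i => ‖k i * c i‖ * r ^ k i) :
    HasDerivAt (fun z => ∑' i, c i * z ^ k i) (∑' i, c i * (k i * x ^ (k i - 1))) x := by
  have hr : 0 < r := (norm_nonneg x).trans_lt hx
  have hball : x ∈ Metric.ball (0 : ℂ) r := by simpa using hx
  refine hasDerivAt_tsum_of_isPreconnected (h'.div_const r) Metric.isOpen_ball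
    (convex_ball (0 : ℂ) r).isPreconnected
    (fun i z _ => (hasDerivAt_pow (k i) z).const_mul (c i)) (fun i z hz => ?_) hball ?_ hball
  · have hz : ‖z‖ ≤ r := by simpa using (Metric.mem_ball.1 hz).le
    rcases Nat.eq_zero_or_pos (k i) with h0 | h0
    · simp [h0]
    · obtain ⟨m, hm⟩ := Nat.exists_eq_succ_of_ne_zero h0.ne'
      simp only [hm, norm_mul, norm_pow, Nat.succ_eq_add_one, Nat.add_sub_cancel, pow_succ]
      rw [← mul_assoc (_ * _), mul_div_assoc, div_self hr.ne', mul_one, ← mul_assoc,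
        mul_comm ‖c i‖]
      gcongr
  · refine Summable.of_norm_bounded h fun i => ?_
    rw [norm_mul, norm_pow]
    gcongr

lemma tsum_succ_fst {f : ℕ × ℕ → ℂ} (hf : ∀ n, f (0, n) = 0) :
    ∑' p : ℕ × ℕ, f (p.1 + 1, p.2) = ∑' p, f p := by
  refine Function.Injective.tsum_eq (g := fun p : ℕ × ℕ => (p.1 + 1, p.2)) ?_ ?_
  · rintro ⟨m, n⟩ ⟨m', n'⟩ h
    simpa using h
  · rintro ⟨_ | m, n⟩ h
    · exact absurd (hf n) h
    · exact ⟨(m, n), rfl⟩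

lemma tsum_succ_snd {f : ℕ × ℕ → ℂ} (hf : ∀ m, f (m, 0) = 0) :
    ∑' p : ℕ × ℕ, f (p.1, p.2 + 1) = ∑' p, f p := by
  refine Function.Injective.tsum_eq (g := fun p : ℕ × ℕ => (p.1, p.2 + 1)) ?_ ?_
  · rintro ⟨m, n⟩ ⟨m', n'⟩ h
    simpa using h
  · rintro ⟨m, _ | n⟩ h
    · exact absurd (hf m) h
    · exact ⟨(m, n), rfl⟩

lemma mul_doubleSum_derivFst (a : ℕ × ℕ → ℂ) (x y : ℂ) :
    x * doubleSum (derivFst a) x y = doubleSum (fun p => p.1 * a p) x y := by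
  simp only [doubleSum]
  rw [← tsum_succ_fst (f := fun p => p.1 * a p * x ^ p.1 * y ^ p.2) (by simp), ← tsum_mul_left]
  refine tsum_congr fun p => ?_
  simp only [derivFst]
  push_cast
  ring

lemma mul_doubleSum_derivSnd (a : ℕ × ℕ → ℂ) (x y : ℂ) :
    y * doubleSum (derivSnd a) x y = doubleSum (fun p => p.2 * a p) x y := by
  simp only [doubleSum]
  rw [← tsum_succ_snd (f := fun p => p.2 * a p * x ^ p.1 * y ^ p.2) (by simp), ← tsum_mul_left]
  refine tsum_congr fun p => ?_
  simp only [derivSnd]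
  push_cast
  ring

lemma TermsBounded.hasDerivAt_fst {a : ℕ × ℕ → ℂ} (ha : TermsBounded a) {x : ℂ} (hx : ‖x‖ < 1)
    (y : ℂ) : HasDerivAt (fun z => doubleSum a z y) (doubleSum (KampeDeFeriet.derivFst a) x y) x := by
  obtain ⟨r, hxr, hr1⟩ := exists_between hx
  have hr : 0 < r := (norm_nonneg x).trans_lt hxr
  have hs : 0 < ‖y‖ + 1 := by positivity
  have key := hasDerivAt_tsum_mul_pow (fun p : ℕ × ℕ => a p * y ^ p.2) Prod.fst hxr ?_ ?_
  · convert key using 1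
    · funext z
      exact tsum_congr fun p => by ring
    · rw [← tsum_succ_fst (by simp)]
      refine tsum_congr fun p => ?_
      simp only [KampeDeFeriet.derivFst, Nat.add_sub_cancel]
      push_cast
      ring
  · refine Summable.of_nonneg_of_le (fun p => by positivity) (fun p => ?_)
      (ha.summable_norm hr hr1 hs)
    rw [norm_mul, norm_pow, mul_right_comm]
    gcongr
    exact (lt_add_one _).le
  · refine Summable.of_nonneg_of_le (fun p => by positivity) (fun p => ?_)
      (ha.natCast_fst_mul.summable_norm hr hr1 hs)
    rw [← mul_assoc, norm_mul, norm_pow, mul_right_comm]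
    gcongr
    exact (lt_add_one _).le

lemma TermsBounded.hasDerivAt_snd {a : ℕ × ℕ → ℂ} (ha : TermsBounded a) {x : ℂ} (hx : ‖x‖ < 1)
    (y : ℂ) : HasDerivAt (fun z => doubleSum a x z) (doubleSum (derivSnd a) x y) y := by
  obtain ⟨r, hxr, hr1⟩ := exists_between hx
  have hr : 0 < r := (norm_nonneg x).trans_lt hxr
  have hs : 0 < ‖y‖ + 1 := by positivity
  have key := hasDerivAt_tsum_mul_pow (fun p : ℕ × ℕ => a p * x ^ p.1) Prod.snd
    (lt_add_one ‖y‖) ?_ ?_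
  · refine key.congr_deriv ?_
    simp only [doubleSum]
    rw [← tsum_succ_snd (by simp)]
    refine tsum_congr fun p => ?_
    simp only [derivSnd, Nat.add_sub_cancel]
    push_cast
    ring
  · refine Summable.of_nonneg_of_le (fun p => by positivity) (fun p => ?_)
      (ha.summable_norm hr hr1 hs)
    rw [norm_mul, norm_pow]
    gcongr
  · refine Summable.of_nonneg_of_le (fun p => by positivity) (fun p => ?_)
      (ha.natCast_snd_mul.summable_norm hr hr1 hs)
    rw [← mul_assoc, norm_mul, norm_pow]
    gcongr

lemma poch_succ (a : ℂ) (n : ℕ) : poch a (n + 1) = poch a n * (a + n) :=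
  Finset.prod_range_succ _ _

lemma add_natCast_ne_zero {a : ℂ} (ha : ∀ n : ℕ, a ≠ -(n : ℂ)) (n : ℕ) : a + n ≠ 0 :=
  fun h => ha n (eq_neg_of_add_eq_zero_left h)

lemma poch_ne_zero {a : ℂ} (ha : ∀ n : ℕ, a ≠ -(n : ℂ)) (n : ℕ) : poch a n ≠ 0 :=
  Finset.prod_ne_zero_iff.2 fun i _ => add_natCast_ne_zero ha i

lemma coeff_succ_fst {b c d e g : ℂ} (he : ∀ n : ℕ, e ≠ -(n : ℂ))
    (hg : ∀ n : ℕ, g ≠ -(n : ℂ)) (m n : ℕ) :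
    (e + m + n) * (m + 1) * coeff b c d e g (m + 1, n) =
      (b + m) * (c + m) * coeff b c d e g (m, n) := by
  have h1 := poch_ne_zero he (m + n)
  have h2 := poch_ne_zero hg n
  have h3 : e + m + n ≠ 0 := by simpa [add_assoc] using add_natCast_ne_zero he (m + n)
  have h4 : (m : ℂ) + 1 ≠ 0 := Nat.cast_add_one_ne_zero m
  have h5 : (m.factorial : ℂ) ≠ 0 := by exact_mod_cast m.factorial_ne_zero
  have h6 : (n.factorial : ℂ) ≠ 0 := by exact_mod_cast n.factorial_ne_zero
  simp only [coeff, Nat.add_right_comm m 1 n, poch_succ, Nat.factorial_succ]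
  push_cast
  rw [← add_assoc e]
  field_simp

lemma coeff_succ_snd {b c d e g : ℂ} (he : ∀ n : ℕ, e ≠ -(n : ℂ))
    (hg : ∀ n : ℕ, g ≠ -(n : ℂ)) (m n : ℕ) :
    (e + m + n) * (g + n) * (n + 1) * coeff b c d e g (m, n + 1) =
      (d + n) * coeff b c d e g (m, n) := by
  have h1 := poch_ne_zero he (m + n)
  have h2 := poch_ne_zero hg n
  have h3 : e + m + n ≠ 0 := by simpa [add_assoc] using add_natCast_ne_zero he (m + n)
  have h4 : (n : ℂ) + 1 ≠ 0 := Nat.cast_add_one_ne_zero n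
  have h5 : (m.factorial : ℂ) ≠ 0 := by exact_mod_cast m.factorial_ne_zero
  have h6 : (n.factorial : ℂ) ≠ 0 := by exact_mod_cast n.factorial_ne_zero
  have h7 := add_natCast_ne_zero hg n
  simp only [coeff, ← add_assoc m n 1, poch_succ, Nat.factorial_succ]
  push_cast
  rw [← add_assoc e]
  field_simp

lemma exists_le_of_eventually_succ_le {f : ℕ → ℝ} (hf : ∀ᶠ n in atTop, f (n + 1) ≤ f n) :
    ∃ C, 0 ≤ C ∧ ∀ n, f n ≤ C := by
  obtain ⟨N, hN⟩ := eventually_atTop.1 hf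
  have hle : ∀ n, f n ≤ ∑ i ∈ Finset.range (N + 1), |f i| := by
    intro n
    have hmem : ∀ k ≤ N, f k ≤ ∑ i ∈ Finset.range (N + 1), |f i| := fun k hk =>
      (le_abs_self _).trans (Finset.single_le_sum (f := fun i => |f i|)
        (fun _ _ => abs_nonneg _) (Finset.mem_range.2 (Nat.lt_succ_of_le hk)))
    rcases le_total n N with h | h
    · exact hmem n h
    · induction n, h using Nat.le_induction with
      | base => exact hmem N le_rfl
      | succ n hn ih => exact (hN n hn).trans ih
  exact ⟨_, Finset.sum_nonneg fun _ _ => abs_nonneg _, hle⟩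

lemma exists_le_of_eventually_succ_le_fst {f : ℕ × ℕ → ℝ}
    (h₁ : ∀ᶠ m in atTop, ∀ n, f (m + 1, n) ≤ f (m, n))
    (h₂ : ∀ m, ∀ᶠ n in atTop, f (m, n + 1) ≤ f (m, n)) : ∃ C, ∀ p, f p ≤ C := by
  choose K hK0 hK using fun m => exists_le_of_eventually_succ_le (f := fun n => f (m, n)) (h₂ m)
  obtain ⟨M, hM⟩ := eventually_atTop.1 h₁
  refine ⟨∑ i ∈ Finset.range (M + 1), K i, ?_⟩
  rintro ⟨m, n⟩
  have hmem : ∀ k ≤ M, f (k, n) ≤ ∑ i ∈ Finset.range (M + 1), K i := fun k hk =>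
    (hK k n).trans (Finset.single_le_sum (fun i _ => hK0 i)
      (Finset.mem_range.2 (Nat.lt_succ_of_le hk)))
  rcases le_total m M with h | h
  · exact hmem m h
  · induction m, h using Nat.le_induction with
    | base => exact hmem M le_rfl
    | succ m hm ih => exact (hM m hm n).trans ih

lemma natCast_sub_norm_le (a : ℂ) (n : ℕ) : n - ‖a‖ ≤ ‖a + n‖ := by
  have h := norm_sub_le (a + n) a
  rw [add_sub_cancel_left, Complex.norm_natCast] at h
  linarith

lemma norm_add_natCast_le (a : ℂ) (n : ℕ) : ‖a + n‖ ≤ ‖a‖ + n := by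
  simpa using norm_add_le a (n : ℂ)

lemma termsBounded_coeff {b c d e g : ℂ} (he : ∀ n : ℕ, e ≠ -(n : ℂ))
    (hg : ∀ n : ℕ, g ≠ -(n : ℂ)) : TermsBounded (coeff b c d e g) := by
  intro r s hr hr1 hs
  apply exists_le_of_eventually_succ_le_fst
  · have hr' : 0 < 1 - r := by linarith
    have hlarge : ∀ᶠ m : ℕ in atTop,
        (‖b‖ + ‖c‖ + ‖e‖ + ‖b‖ * ‖c‖ + ‖e‖) / (1 - r) + 1 ≤ (m : ℝ) :=
      tendsto_natCast_atTop_atTop.eventually_ge_atTop _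
    filter_upwards [hlarge] with m hm n
    have hm1 : 1 ≤ (m : ℝ) := le_trans (by linarith [show
      0 ≤ (‖b‖ + ‖c‖ + ‖e‖ + ‖b‖ * ‖c‖ + ‖e‖) / (1 - r) by positivity]) hm
    have hmr : ‖b‖ + ‖c‖ + ‖e‖ + ‖b‖ * ‖c‖ + ‖e‖ ≤ m * (1 - r) := by
      rw [← div_le_iff₀ hr']; linarith
    have hrec := congrArg norm (coeff_succ_fst (b := b) (c := c) (d := d) he hg m n)
    have hm1' : ‖(m : ℂ) + 1‖ = m + 1 := by exact_mod_cast Complex.norm_natCast (m + 1)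
    simp only [norm_mul, hm1'] at hrec
    have hden : (m - ‖e‖) * (m + 1) ≤ ‖e + m + n‖ * (m + 1) := by
      have h := natCast_sub_norm_le e (m + n)
      push_cast at h
      rw [← add_assoc] at h
      gcongr
      linarith [(Nat.cast_nonneg n : (0 : ℝ) ≤ n)]
    have hnum : ‖b + m‖ * ‖c + m‖ ≤ (‖b‖ + m) * (‖c‖ + m) := by
      gcongr <;> exact norm_add_natCast_le _ _
    have hratio : (‖b‖ + m) * (‖c‖ + m) * r ≤ (m - ‖e‖) * (m + 1) := by
      have h1 : (‖b‖ + m) * (‖c‖ + m) * r ≤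
          (‖b‖ * ‖c‖ + (‖b‖ + ‖c‖) * m) + m * m * r := by
        have : (‖b‖ * ‖c‖ + (‖b‖ + ‖c‖) * m) * r ≤ (‖b‖ * ‖c‖ + (‖b‖ + ‖c‖) * m) * 1 := by
          gcongr
        linarith
      have h2 := mul_le_mul_of_nonneg_right hmr (by positivity : (0 : ℝ) ≤ m)
      have h3 : (‖b‖ * ‖c‖ + ‖e‖) * 1 ≤ (‖b‖ * ‖c‖ + ‖e‖) * m := by gcongr
      linarith
    have hpos : 0 < ‖e + m + n‖ * (m + 1) := by
      have : e + m + n ≠ 0 := by simpa [add_assoc] using add_natCast_ne_zero he (m + n)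
      positivity
    refine le_of_mul_le_mul_left ?_ hpos
    calc ‖e + m + n‖ * (m + 1) * (‖coeff b c d e g (m + 1, n)‖ * r ^ (m + 1) * s ^ n)
        = (‖e + m + n‖ * (m + 1) * ‖coeff b c d e g (m + 1, n)‖) * r ^ (m + 1) * s ^ n := by ring
      _ = (‖b + m‖ * ‖c + m‖ * r) * (‖coeff b c d e g (m, n)‖ * r ^ m * s ^ n) := by
        rw [hrec]; ring
      _ ≤ (‖e + m + n‖ * (m + 1)) * (‖coeff b c d e g (m, n)‖ * r ^ m * s ^ n) := by
        refine mul_le_mul_of_nonneg_right ?_ (by positivity)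
        exact (mul_le_mul_of_nonneg_right hnum hr.le).trans (hratio.trans hden)
  · intro m
    have hlarge : ∀ᶠ n : ℕ in atTop, ‖e‖ + 1 + ‖g‖ + (‖d‖ + 1) * s ≤ (n : ℝ) :=
      tendsto_natCast_atTop_atTop.eventually_ge_atTop _
    filter_upwards [hlarge] with n hn
    have hds : 0 ≤ (‖d‖ + 1) * s := by positivity
    have hrec := congrArg norm (coeff_succ_snd (b := b) (c := c) (d := d) he hg m n)
    have hn1 : ‖(n : ℂ) + 1‖ = n + 1 := by exact_mod_cast Complex.norm_natCast (n + 1)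
    simp only [norm_mul, hn1] at hrec
    have hE : 1 ≤ ‖e + m + n‖ := by
      have h := natCast_sub_norm_le e (m + n)
      push_cast at h
      rw [← add_assoc] at h
      linarith [(Nat.cast_nonneg m : (0 : ℝ) ≤ m), norm_nonneg g]
    have hG : (‖d‖ + 1) * s ≤ ‖g + n‖ := by
      linarith [natCast_sub_norm_le g n, norm_nonneg e]
    have hratio : ‖d + n‖ * s ≤ ‖e + m + n‖ * ‖g + n‖ * (n + 1) := by
      calc ‖d + n‖ * s ≤ ((‖d‖ + 1) * (n + 1)) * s := by
            gcongr
            have : 0 ≤ ‖d‖ * n := by positivity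
            linarith [norm_add_natCast_le d n]
        _ = 1 * ((‖d‖ + 1) * s) * (n + 1) := by ring
        _ ≤ ‖e + m + n‖ * ‖g + n‖ * (n + 1) := by gcongr
    have hpos : 0 < ‖e + m + n‖ * ‖g + n‖ * (n + 1) := by
      have := (by positivity : 0 < (‖d‖ + 1) * s).trans_le hG
      have := zero_lt_one.trans_le hE
      positivity
    refine le_of_mul_le_mul_left ?_ hpos
    calc ‖e + m + n‖ * ‖g + n‖ * (n + 1) *
          (‖coeff b c d e g (m, n + 1)‖ * r ^ m * s ^ (n + 1))
        = (‖e + m + n‖ * ‖g + n‖ * (n + 1) * ‖coeff b c d e g (m, n + 1)‖) *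
          r ^ m * s ^ (n + 1) := by ring
      _ = (‖d + n‖ * s) * (‖coeff b c d e g (m, n)‖ * r ^ m * s ^ n) := by
        rw [hrec]; ring
      _ ≤ _ := mul_le_mul_of_nonneg_right hratio (by positivity)

/-- The differential equation in terms of the termwise derivatives. -/
lemma doubleSum_coeff_equation {b c d e g : ℂ} (he : ∀ n : ℕ, e ≠ -(n : ℂ))
    (hg : ∀ n : ℕ, g ≠ -(n : ℂ)) {x : ℂ} (hx : ‖x‖ < 1) (y : ℂ) :
    x * (1 - x) * doubleSum (derivFst (derivFst (coeff b c d e g))) x y +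
      y * doubleSum (derivSnd (derivFst (coeff b c d e g))) x y +
      (e - (b + c + 1) * x) * doubleSum (derivFst (coeff b c d e g)) x y -
      b * c * doubleSum (coeff b c d e g) x y = 0 := by
  set A := coeff b c d e g with hA
  have hbd : TermsBounded A := termsBounded_coeff he hg
  have hxx := mul_doubleSum_derivFst (derivFst A) x y
  have hxy := mul_doubleSum_derivSnd (derivFst A) x y
  have hx1 := mul_doubleSum_derivFst A x y
  have hxxx : x * doubleSum (fun p => p.1 * derivFst A p) x y =
      doubleSum (fun p => p.1 * ((p.1 - 1) * A p)) x y := by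
    rw [← mul_doubleSum_derivFst fun p => (p.1 - 1) * A p]
    congr 2
    funext p
    simp only [derivFst]
    push_cast
    ring
  have hsq : Summable fun p : ℕ × ℕ => (p.1 * ((p.1 - 1) * A p)) * x ^ p.1 * y ^ p.2 := by
    refine ((hbd.natCast_fst_mul.natCast_fst_mul.summable (y := y) hx).sub
      (hbd.natCast_fst_mul.summable (y := y) hx)).congr fun p => ?_
    ring
  have hsum := (((((hbd.derivFst.natCast_fst_mul.summable (y := y) hx).hasSum.sub
    hsq.hasSum).add (hbd.derivFst.natCast_snd_mul.summable (y := y) hx).hasSum).add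
    ((hbd.derivFst.summable (y := y) hx).hasSum.mul_left e)).sub
    ((hbd.natCast_fst_mul.summable (y := y) hx).hasSum.mul_left (b + c + 1))).sub
    ((hbd.summable (y := y) hx).hasSum.mul_left (b * c))
  have hzero := hsum.unique (hasSum_zero.congr_fun ?_)
  · change doubleSum (fun p => p.1 * derivFst A p) x y -
      doubleSum (fun p => p.1 * ((p.1 - 1) * A p)) x y +
      doubleSum (fun p => p.2 * derivFst A p) x y + e * doubleSum (derivFst A) x y -
      (b + c + 1) * doubleSum (fun p => p.1 * A p) x y - b * c * doubleSum A x y = 0 at hzero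
    linear_combination hzero + (1 - x) * hxx + hxy - (b + c + 1) * hx1 - hxxx
  · rintro ⟨m, n⟩
    have hrec := coeff_succ_fst (b := b) (c := c) (d := d) he hg m n
    rw [← hA] at hrec
    simp only [derivFst]
    linear_combination x ^ m * y ^ n * hrec

lemma TermsBounded.deriv_fst {a : ℕ × ℕ → ℂ} (ha : TermsBounded a) {x : ℝ} (hx : |x| < 1) (y : ℝ) :
    deriv (fun t : ℝ => doubleSum a t y) x = doubleSum (KampeDeFeriet.derivFst a) x y :=
  (ha.hasDerivAt_fst (by simpa using hx) (y : ℂ)).comp_ofReal.deriv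

lemma TermsBounded.deriv_snd {a : ℕ × ℕ → ℂ} (ha : TermsBounded a) {x : ℝ} (hx : |x| < 1) (y : ℝ) :
    deriv (fun t : ℝ => doubleSum a x t) y = doubleSum (derivSnd a) x y :=
  (ha.hasDerivAt_snd (by simpa using hx) (y : ℂ)).comp_ofReal.deriv

end KampeDeFeriet

open KampeDeFeriet in
theorem stmt4 (b c d e g : ℂ)
    (he : ∀ n : ℕ, e ≠ -(n : ℂ)) (hg : ∀ n : ℕ, g ≠ -(n : ℂ))
    (u : ℝ → ℝ → ℂ)
    (hu : u = fun x y : ℝ => F2 b c d e g (x : ℂ) (y : ℂ)) :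
    ∀ x y : ℝ, 0 < x → x < 1 → 0 < y →
      (x : ℂ) * (1 - (x : ℂ)) * pdx (pdx u) x y + (y : ℂ) * pdy (pdx u) x y
        + (e - (b + c + 1) * (x : ℂ)) * pdx u x y - b * c * u x y = 0 := by
  intro x y hx0 hx1 _
  have hbd : TermsBounded (coeff b c d e g) := termsBounded_coeff he hg
  have hx : |x| < 1 := by rwa [abs_of_pos hx0]
  have hux : ∀ t z : ℝ, |t| < 1 → pdx u t z = doubleSum (derivFst (coeff b c d e g)) t z := by
    intro t z ht
    subst hu
    exact hbd.deriv_fst ht z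
  have huxx : pdx (pdx u) x y = doubleSum (derivFst (derivFst (coeff b c d e g))) x y := by
    rw [← hbd.derivFst.deriv_fst hx y]
    refine Filter.EventuallyEq.deriv_eq ?_
    filter_upwards [(continuous_abs.isOpen_preimage _ isOpen_Iio).mem_nhds hx] with t ht
    exact hux t y ht
  have huxy : pdy (pdx u) x y = doubleSum (derivSnd (derivFst (coeff b c d e g))) x y := by
    rw [← hbd.derivFst.deriv_snd hx y]
    simp only [pdy, hux x _ hx]
  have hval : u x y = doubleSum (coeff b c d e g) x y := by
    rw [hu]
    rfl
  rw [huxx, huxy, hux x y hx, hval]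
  exact doubleSum_coeff_equation he hg (by simpa using hx) y
end
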